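/- Let (X,+) be a commutative semigroup, k⃗ = (kₙ)_{n∈ℕ} an increasing sequence of positive integers, and for every l ∈ ℕ let (y_{l,n})_{n∈ℕ} be a sequence in X. If U ⊆ X^ℕ is a pointwise closed family, then there exist sequences (Eₙ)_{n∈ℕ} and (Hₙ)_{n∈ℕ} of nonempty finite subsets of ℕ with max Eₙ < min Eₙ₊₁ and Hₙ ⊆ Eₙ for every n ∈ ℕ, and a sequence (βₙ)_{n∈ℕ} in X with βₙ = Σ_{j∈Eₙ∖Hₙ} y_{lⁿⱼ,j} for some choices 1 ≤ lⁿⱼ ≤ kⱼ, such that for every function f : ℕ → ℕ with f(n) ≤ kₙ for every n ∈ ℕ, either [FS((βₙ + Σ_{t∈Hₙ} y_{f(n),t})_{n∈ℕ})]^ω ⊆ U or [FS((βₙ + Σ_{t∈Hₙ} y_{f(n),t})_{n∈ℕ})]^ω ⊆ X^ℕ ∖ U. -/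

import Mathlib

namespace Farmaki

variable {X : Type*}

/-- The sum of a nonempty list in a semigroup (junk value on the empty list). -/
noncomputable def listSum1 [AddSemigroup X] [Nonempty X] (l : List X) : X :=
  match l with
  | [] => Classical.arbitrary X
  | a :: t => t.foldl (· + ·) a

/-- The sum `Σ_{j ∈ E} g j` over a nonempty finite set in a commutative semigroup
(junk value on the empty set). -/
noncomputable def finsetSum1 [AddCommSemigroup X] [Nonempty X] (g : ℕ → X) (E : Finset ℕ) : X :=
  listSum1 ((E.sort (· ≤ ·)).map g)

/-- `FS((xₙ)ₙ)`: all finite sums `x_{n₁} + ⋯ + x_{n_λ}` with `n₁ < ⋯ < n_λ`. -/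
noncomputable def FSset [AddSemigroup X] [Nonempty X] (x : ℕ → X) : Set X :=
  {y | ∃ F : List ℕ, F ≠ [] ∧ F.Chain' (· < ·) ∧ y = listSum1 (F.map x)}

/-- `[FS((xₙ)ₙ)]^ω`: all sequences `(yₙ)` with `yₙ ∈ FS((xₙ)ₙ)` and `yₙ < yₙ₊₁`,
i.e. admitting representations by successive blocks of indices. -/
noncomputable def FSseq [AddSemigroup X] [Nonempty X] (x : ℕ → X) : Set (ℕ → X) :=
  {z | ∃ F : ℕ → List ℕ, (∀ n, F n ≠ []) ∧ (∀ n, (F n).Chain' (· < ·)) ∧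
    (∀ n, ∀ a ∈ F n, ∀ b ∈ F (n + 1), a < b) ∧
    ∀ n, z n = listSum1 ((F n).map x)}

end Farmaki

namespace Farmaki

section Ramsey

variable {S : Type*}

/-- Prepend a term to a sequence. -/
def seqCons (x : S) (z : ℕ → S) : ℕ → S
  | 0 => x
  | n + 1 => z n

lemma seqCons_head_tail (z : ℕ → S) : seqCons (z 0) (fun n => z (n + 1)) = z := by
  funext n
  cases n <;> rfl

/-- The family of tails of those sequences in `V` that start with `x`. -/
def seqSection (V : Set (ℕ → S)) (x : S) : Set (ℕ → S) := {z | seqCons x z ∈ V}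

/-- `V` can be reached by a well-founded tree of `p`-large branchings. -/
inductive Accepts (p : Ultrafilter S) : Set (ℕ → S) → Prop
  | univ : Accepts p Set.univ
  | step (V : Set (ℕ → S)) (A : Set S) (hA : A ∈ p)
      (h : ∀ x ∈ A, Accepts p (seqSection V x)) : Accepts p V

/-- `z` is a branch of the tree in which the node `s` branches along `D s`. -/
def IsBranch (D : List S → Set S) (z : ℕ → S) : Prop :=
  ∀ n, z n ∈ D ((List.range n).map z)

lemma IsBranch.tail {D : List S → Set S} {z : ℕ → S} (h : IsBranch D z) :
    IsBranch (fun s => D (z 0 :: s)) (fun n => z (n + 1)) := by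
  intro n
  have := h (n + 1)
  rw [List.range_succ_eq_map, List.map_cons, List.map_map] at this
  exact this

lemma Accepts.exists_tree {p : Ultrafilter S} {V : Set (ℕ → S)} (h : Accepts p V) :
    ∃ D : List S → Set S, (∀ s, D s ∈ p) ∧ ∀ z, IsBranch D z → z ∈ V := by
  classical
  induction h with
  | univ => exact ⟨fun _ => Set.univ, fun _ => Filter.univ_mem, fun _ _ => trivial⟩
  | step V A hA _ ih =>
    choose! G hG hGV using ih
    refine ⟨fun s => match s with
      | [] => A
      | x :: t => if x ∈ A then G x t else Set.univ, ?_, ?_⟩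
    · rintro (_ | ⟨x, t⟩)
      · exact hA
      · by_cases hx : x ∈ A
        · simpa [hx] using hG x hx t
        · simp only [hx, if_false]
          exact Filter.univ_mem (f := (p : Filter S))
    · intro z hz
      have h0 : z 0 ∈ A := hz 0
      have ht := hz.tail
      simp only [h0, if_true] at ht
      have := hGV (z 0) h0 _ ht
      rwa [seqSection, Set.mem_ofPred_eq, seqCons_head_tail] at this

/-- The set of `x` after which the family of tails of `V` is still not accepted, along the
finite sequence given by the list. -/
def rejectTree (p : Ultrafilter S) : Set (ℕ → S) → List S → Set S
  | V, [] => {x | ¬ Accepts p V → ¬ Accepts p (seqSection V x)}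
  | V, x :: s => rejectTree p (seqSection V x) s

lemma rejectTree_mem (p : Ultrafilter S) (V : Set (ℕ → S)) (s : List S) :
    rejectTree p V s ∈ p := by
  induction s generalizing V with
  | nil =>
    by_contra hn
    rw [← Ultrafilter.compl_mem_iff_notMem] at hn
    obtain ⟨x, hx⟩ := Ultrafilter.nonempty_of_mem hn
    simp only [rejectTree, Set.mem_compl_iff, Set.mem_ofPred_eq, Classical.not_imp,
      not_not] at hx
    refine hx.1 (Accepts.step V _ hn fun x hx => ?_)
    simp only [rejectTree, Set.mem_compl_iff, Set.mem_ofPred_eq, Classical.not_imp,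
      not_not] at hx
    exact hx.2
  | cons x s ih => exact ih _

lemma exists_notMem_of_not_accepts {p : Ultrafilter S} (n : ℕ) {V : Set (ℕ → S)}
    (hV : ¬ Accepts p V) {z : ℕ → S} (hz : IsBranch (rejectTree p V) z) :
    ∃ z', (∀ i < n, z' i = z i) ∧ z' ∉ V := by
  induction n generalizing V z with
  | zero =>
    by_contra! hcon
    have : V = Set.univ := Set.eq_univ_of_forall fun z' => hcon z' (by simp)
    exact hV (this ▸ Accepts.univ)
  | succ n ih =>
    obtain ⟨z', h1, h2⟩ := ih (V := seqSection V (z 0)) (hz 0 hV) hz.tail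
    refine ⟨seqCons (z 0) z', fun i hi => ?_, h2⟩
    cases i with
    | zero => rfl
    | succ i => exact h1 i (by omega)

/-- The Ramsey property of open families of sequences with respect to trees that branch along
sets of an ultrafilter. -/
theorem exists_homogeneous_tree (p : Ultrafilter S) (V : Set (ℕ → S))
    (hV : ∀ z ∈ V, ∃ n, ∀ z' : ℕ → S, (∀ i < n, z' i = z i) → z' ∈ V) :
    ∃ D : List S → Set S, (∀ s, D s ∈ p) ∧
      ((∀ z, IsBranch D z → z ∈ V) ∨ ∀ z, IsBranch D z → z ∉ V) := by
  by_cases h : Accepts p V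
  · obtain ⟨D, hD, hDV⟩ := h.exists_tree
    exact ⟨D, hD, Or.inl hDV⟩
  · refine ⟨rejectTree p V, rejectTree_mem p V, Or.inr fun z hz hzV => ?_⟩
    obtain ⟨n, hn⟩ := hV z hzV
    obtain ⟨z', h1, h2⟩ := exists_notMem_of_not_accepts n h hz
    exact h2 (hn z' h1)

end Ramsey

section Words

/-- Substitute the letter `a` at the positions `H` of the variable in the word with constant
part `c`. Located words are finitely supported functions, with `0` marking the positions outside
the domain. -/
noncomputable def subst (c : ℕ →₀ ℕ) (H : Finset ℕ) (a : ℕ) : ℕ →₀ ℕ :=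
  c + ∑ j ∈ H, Finsupp.single j a

lemma subst_apply (c : ℕ →₀ ℕ) (H : Finset ℕ) (a j : ℕ) :
    subst c H a j = c j + if j ∈ H then a else 0 := by
  simp [subst, Finsupp.single_apply]

lemma support_subst (c : ℕ →₀ ℕ) (H : Finset ℕ) {a : ℕ} (ha : 1 ≤ a) :
    (subst c H a).support = c.support ∪ H := by
  ext j
  simp only [Finsupp.mem_support_iff, subst_apply, Finset.mem_union]
  split_ifs with h <;> simp [h]
  omega

/-- `(c, H)` is a variable word supported in `[N, ∞)`, with letters dominated by `k`. -/
structure IsVarWord (k : ℕ → ℕ) (N : ℕ) (c : ℕ →₀ ℕ) (H : Finset ℕ) : Prop where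
  nonempty : H.Nonempty
  disjoint : Disjoint c.support H
  le_of_mem : ∀ j ∈ c.support ∪ H, N ≤ j
  le_bound : ∀ j, c j ≤ k j

/-- `A` contains all instances of some variable word supported in `[N, ∞)`. -/
def HasLine (k : ℕ → ℕ) (N : ℕ) (A : Set (ℕ →₀ ℕ)) : Prop :=
  ∃ c H, IsVarWord k N c H ∧ ∀ a, 1 ≤ a → a ≤ k N → subst c H a ∈ A

variable {k : ℕ → ℕ}

lemma HasLine.anti (hmono : Monotone k) {M N : ℕ} (h : M ≤ N) {A : Set (ℕ →₀ ℕ)}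
    (hA : HasLine k N A) : HasLine k M A := by
  obtain ⟨c, H, hw, hA⟩ := hA
  exact ⟨c, H, ⟨hw.nonempty, hw.disjoint, fun j hj => h.trans (hw.le_of_mem j hj), hw.le_bound⟩,
    fun a h1 h2 => hA a h1 (h2.trans (hmono h))⟩

/-- The Hales–Jewett theorem for located words. -/
lemma exists_hasLine_preimage (hmono : Monotone k) {κ : Type*} [Finite κ]
    (C : (ℕ →₀ ℕ) → κ) (N : ℕ) : ∃ r, HasLine k N (C ⁻¹' {r}) := by
  classical
  obtain ⟨ι, _, hι⟩ := Combinatorics.Line.exists_mono_in_high_dimension (Fin (k N)) κ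
  let g : ι → ℕ := fun i => N + Fintype.equivFin ι i
  have hg : Function.Injective g := fun i j h => by
    simpa [g, Fin.val_inj] using h
  have hgN : ∀ i, N ≤ g i := fun i => Nat.le_add_right _ _
  obtain ⟨l, r, hl⟩ := hι fun v => C (∑ i, Finsupp.single (g i) ((v i : ℕ) + 1))
  let d : ι → ℕ := fun i => (l.idxFun i).elim 0 fun b => (b : ℕ) + 1
  let c : ℕ →₀ ℕ := ∑ i, Finsupp.single (g i) (d i)
  let H : Finset ℕ := (Finset.univ.filter fun i => l.idxFun i = none).image g
  have hcg : ∀ i, c (g i) = d i := fun i => by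
    simp [c, Finsupp.finsetSum_apply, Finsupp.single_apply, hg.eq_iff]
  have hc0 : ∀ j, (∀ i, g i ≠ j) → c j = 0 := fun j hj => by
    simp [c, Finsupp.finsetSum_apply, hj]
  have hdk : ∀ i, d i ≤ k N := fun i => by
    simp only [d]
    cases l.idxFun i with
    | none => simp
    | some b => exact b.2
  refine ⟨r, c, H, ⟨?_, ?_, ?_, ?_⟩, ?_⟩
  · obtain ⟨i, hi⟩ := l.proper
    exact ⟨g i, Finset.mem_image_of_mem _ (by simpa using hi)⟩
  · rw [Finset.disjoint_right]
    intro j hj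
    obtain ⟨i, hi, rfl⟩ := Finset.mem_image.1 hj
    have hi : l.idxFun i = none := by simpa using hi
    simp [hcg, d, hi]
  · intro j hj
    by_cases hjg : ∃ i, g i = j
    · obtain ⟨i, rfl⟩ := hjg
      exact hgN i
    · push Not at hjg
      rcases Finset.mem_union.1 hj with hj | hj
      · exact absurd (hc0 j hjg) (Finsupp.mem_support_iff.1 hj)
      · obtain ⟨i, -, hi⟩ := Finset.mem_image.1 hj
        exact absurd hi (hjg i)
  · intro j
    by_cases hjg : ∃ i, g i = j
    · obtain ⟨i, rfl⟩ := hjg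
      rw [hcg]
      exact (hdk i).trans (hmono (hgN i))
    · push Not at hjg
      simp [hc0 j hjg]
  · intro a h1 h2
    have := hl ⟨a - 1, by omega⟩
    rw [Set.mem_preimage, Set.mem_singleton_iff, ← this]
    congr 1
    rw [subst, Finset.sum_image hg.injOn, Finset.sum_filter, ← Finset.sum_add_distrib]
    refine Finset.sum_congr rfl fun i _ => ?_
    cases hi : l.idxFun i with
    | none => simp [d, hi, Nat.sub_add_cancel h1]
    | some b => simp [d, hi]

attribute [local instance] Ultrafilter.add Ultrafilter.addSemigroup

/-- There is an idempotent ultrafilter on located words all of whose members contain lines. -/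
theorem exists_idempotent_hasLine (hk : ∀ n, 0 < k n) (hmono : Monotone k) :
    ∃ p : Ultrafilter (ℕ →₀ ℕ), p + p = p ∧ ∀ A ∈ p, ∀ N, HasLine k N A := by
  classical
  let J : Set (Ultrafilter (ℕ →₀ ℕ)) := {p | ∀ A ∈ p, ∀ N, HasLine k N A}
  have hne : J.Nonempty := by
    let B : Set (Set (ℕ →₀ ℕ)) := {B | ∃ N, ¬ HasLine k N Bᶜ}
    have : (Filter.generate B).NeBot := by
      rw [Filter.generate_neBot_iff]
      intro t htB ht
      by_contra hemp
      have hcov : ∀ x : ℕ →₀ ℕ, ∃ b : t, x ∉ b.1 := by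
        intro x
        by_contra! hx
        exact hemp ⟨x, fun b hb => hx ⟨b, hb⟩⟩
      choose C hC using hcov
      have : Finite t := ht
      choose! M hM using htB
      obtain ⟨N, hN⟩ := (ht.image M).bddAbove
      obtain ⟨b, hb⟩ := exists_hasLine_preimage hmono C N
      obtain ⟨c, H, hw, hb⟩ := hb.anti hmono (hN ⟨b.1, b.2, rfl⟩)
      refine hM b.2 ⟨c, H, hw, fun a h1 h2 => ?_⟩
      have := hC (subst c H a)
      rwa [show C (subst c H a) = b from hb a h1 h2] at this
    refine ⟨Ultrafilter.of (Filter.generate B), fun A hA N => ?_⟩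
    by_contra hn
    have h1 : Aᶜ ∈ Filter.generate B :=
      Filter.GenerateSets.basic ⟨N, by rwa [compl_compl]⟩
    exact Ultrafilter.compl_notMem_iff.2 hA (Ultrafilter.of_le _ h1)
  have hclosed : IsClosed J := by
    have : J = ⋂ A ∈ {A | ¬ ∀ N, HasLine k N A}, {p | Aᶜ ∈ p} := by
      ext p
      simp only [J, Set.mem_iInter, Set.mem_ofPred_eq, Ultrafilter.compl_mem_iff_notMem]
      exact forall_congr' fun A => not_imp_not.symm
    rw [this]
    exact isClosed_biInter fun A _ => ultrafilter_isClosed_basic _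
  obtain ⟨p, hp, hpp⟩ := exists_idempotent_in_compact_add_subsemigroup
    Ultrafilter.continuous_add_left J hne hclosed.isCompact (by
      intro p hp q hq A hA N
      have hA' : {x | {y | x + y ∈ A} ∈ q} ∈ p := hA
      obtain ⟨c, H, hw, hl⟩ := hp _ hA' N
      have hI : (⋂ a ∈ Finset.Icc 1 (k N), {y | subst c H a + y ∈ A}) ∈ q := by
        rw [← Ultrafilter.mem_coe, Filter.biInter_finset_mem]
        intro a ha
        rw [Finset.mem_Icc] at ha
        exact hl a ha.1 ha.2
      obtain ⟨c', H', hw', hl'⟩ := hq _ hI (max N ((c.support ∪ H).sup id + 1))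
      have hfar : ∀ j, j ∈ c'.support ∪ H' → N ≤ j ∧ j ∉ c.support ∪ H := by
        intro j hj
        have := hw'.le_of_mem j hj
        refine ⟨(le_max_left _ _).trans this, fun hj' => ?_⟩
        have h1 : j ≤ (c.support ∪ H).sup id := Finset.le_sup (f := id) hj'
        have h2 := (le_max_right _ _).trans this
        omega
      have hsupp := support_subst c' H' le_rfl
      refine ⟨c + subst c' H' 1, H, ⟨hw.nonempty, ?_, ?_, ?_⟩, ?_⟩
      · rw [Finset.disjoint_right]
        intro j hj hj'
        rcases Finset.mem_union.1 (Finsupp.support_add hj') with h | h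
        · exact Finset.disjoint_right.1 hw.disjoint hj h
        · rw [hsupp] at h
          exact (hfar j h).2 (Finset.mem_union_right _ hj)
      · intro j hj
        rcases Finset.mem_union.1 hj with h | h
        · rcases Finset.mem_union.1 (Finsupp.support_add h) with h | h
          · exact hw.le_of_mem j (Finset.mem_union_left _ h)
          · rw [hsupp] at h
            exact (hfar j h).1
        · exact hw.le_of_mem j (Finset.mem_union_right _ h)
      · intro j
        rw [Finsupp.add_apply]
        by_cases hj : j ∈ c'.support ∪ H'
        · have h0 : c j = 0 := by
            by_contra h0
            exact (hfar j hj).2 (Finset.mem_union_left _ (Finsupp.mem_support_iff.2 h0))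
          rw [h0, zero_add, subst_apply]
          split_ifs with hH
          · have : c' j = 0 := by
              simpa using Finset.disjoint_right.1 hw'.disjoint hH
            rw [this]
            exact hk j
          · exact hw'.le_bound j
        · rw [← hsupp, Finsupp.notMem_support_iff] at hj
          rw [hj]
          exact hw.le_bound j
      · intro a h1 h2
        have := hl' 1 le_rfl (hk _)
        rw [Set.mem_iInter₂] at this
        have := this a (Finset.mem_Icc.2 ⟨h1, h2⟩)
        rw [Set.mem_ofPred_eq] at this
        convert this using 1
        simp only [subst]
        abel)
  exact ⟨p, hpp, hp⟩

end Words

section Fusion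

attribute [local instance] Ultrafilter.add

/-- The elements of `A` by which `A` has a `p`-large translate. -/
def star {S : Type*} [Add S] (p : Ultrafilter S) (A : Set S) : Set S :=
  {x | x ∈ A ∧ ∀ᶠ y in p, x + y ∈ A}

lemma eventually_star {S : Type*} [Add S] {p : Ultrafilter S} (hp : p + p = p) {A : Set S}
    (hA : ∀ᶠ x in p, x ∈ A) : ∀ᶠ x in p, x ∈ star p A := by
  have h : ∀ᶠ x in (p + p : Ultrafilter S), x ∈ A := by rwa [hp]
  rw [Ultrafilter.eventually_add] at h
  exact hA.and h

lemma eventually_add_mem_star {S : Type*} [AddSemigroup S] {p : Ultrafilter S} (hp : p + p = p)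
    {A : Set S} {x : S} (hx : x ∈ star p A) : ∀ᶠ y in p, x + y ∈ star p A := by
  filter_upwards [eventually_star hp (A := {y | x + y ∈ A}) hx.2] with y hy
  refine ⟨hy.1, ?_⟩
  filter_upwards [hy.2] with z hz
  rw [add_assoc]
  exact hz

/-- The states (completed terms, pending partial sum) reachable from `Q` after processing the
variable word `w` with letters up to `m`. -/
noncomputable def nextStates (Q : Finset (List (ℕ →₀ ℕ) × (ℕ →₀ ℕ)))
    (w : (ℕ →₀ ℕ) × Finset ℕ) (m : ℕ) : Finset (List (ℕ →₀ ℕ) × (ℕ →₀ ℕ)) :=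
  Q ∪ (Q ×ˢ Finset.Icc 1 m).image (fun q => (q.1.1, q.1.2 + subst w.1 w.2 q.2)) ∪
    (Q ×ˢ Finset.Icc 1 m).image (fun q => (q.1.1 ++ [q.1.2 + subst w.1 w.2 q.2], 0))

variable {k : ℕ → ℕ}

/-- Fusion: variable words such that all sequences of reduced words are branches of `D`. -/
theorem exists_fusion (hmono : Monotone k) {p : Ultrafilter (ℕ →₀ ℕ)} (hp : p + p = p)
    (hline : ∀ A ∈ p, ∀ N, HasLine k N A) (D : List (ℕ →₀ ℕ) → Set (ℕ →₀ ℕ))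
    (hD : ∀ s, D s ∈ p) :
    ∃ w : ℕ → (ℕ →₀ ℕ) × Finset ℕ, (∀ n, IsVarWord k n (w n).1 (w n).2) ∧
      (∀ n, ∀ i ∈ (w n).1.support ∪ (w n).2, ∀ j ∈ (w (n + 1)).1.support ∪ (w (n + 1)).2,
        i < j) ∧
      ∀ f : ℕ → ℕ, (∀ n, 1 ≤ f n ∧ f n ≤ k n) → ∀ F : ℕ → List ℕ, (∀ n, F n ≠ []) →
        (∀ n, (F n).Pairwise (· < ·)) → (∀ n, ∀ a ∈ F n, ∀ b ∈ F (n + 1), a < b) →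
        IsBranch D fun n => ((F n).map fun i => subst (w i).1 (w i).2 (f i)).sum := by
  let Valid : Finset (List (ℕ →₀ ℕ) × (ℕ →₀ ℕ)) → Prop := fun Q =>
    ∀ q ∈ Q, ∀ᶠ x in p, q.2 + x ∈ star p (D q.1)
  let τ := {s : Finset (List (ℕ →₀ ℕ) × (ℕ →₀ ℕ)) × ((ℕ →₀ ℕ) × Finset ℕ) // Valid s.1}
  have hclosed : ∀ s, ∀ᶠ x in p, (0 : ℕ →₀ ℕ) + x ∈ star p (D s) := fun s => by
    simpa only [zero_add] using eventually_star hp (hD s)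
  have hstep : ∀ (n : ℕ) (s : τ), ∃ s' : τ, s'.1.1 = nextStates s.1.1 s'.1.2 (k n) ∧
      IsVarWord k n s'.1.2.1 s'.1.2.2 ∧
      (∀ i ∈ s.1.2.1.support ∪ s.1.2.2, ∀ j ∈ s'.1.2.1.support ∪ s'.1.2.2, i < j) ∧
      ∀ q ∈ s.1.1, ∀ a, 1 ≤ a → a ≤ k n →
        q.2 + subst s'.1.2.1 s'.1.2.2 a ∈ star p (D q.1) := by
    rintro n ⟨⟨Q, v⟩, hQ⟩
    have hA : (⋂ q ∈ Q, {x | q.2 + x ∈ star p (D q.1)}) ∈ p := by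
      rw [← Ultrafilter.mem_coe, Filter.biInter_finset_mem]
      exact hQ
    obtain ⟨c, H, hw, hl⟩ := hline _ hA (max n ((v.1.support ∪ v.2).sup id + 1))
    have hl : ∀ q ∈ Q, ∀ a, 1 ≤ a → a ≤ k n → q.2 + subst c H a ∈ star p (D q.1) := by
      intro q hq a h1 h2
      have := hl a h1 (h2.trans (hmono (le_max_left _ _)))
      rw [Set.mem_iInter₂] at this
      exact this q hq
    refine ⟨⟨⟨nextStates Q (c, H) (k n), (c, H)⟩, ?_⟩, rfl,
      ⟨hw.nonempty, hw.disjoint, fun j hj => (le_max_left _ _).trans (hw.le_of_mem j hj),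
        hw.le_bound⟩, ?_, hl⟩
    · intro q hq
      simp only [nextStates, Finset.mem_union, Finset.mem_image, Finset.mem_product,
        Finset.mem_Icc, Prod.exists] at hq
      rcases hq with (hq | ⟨s, u, a, ⟨hq, h1, h2⟩, rfl⟩) | ⟨s, u, a, ⟨hq, h1, h2⟩, rfl⟩
      · exact hQ q hq
      · exact eventually_add_mem_star hp (hl _ hq a h1 h2)
      · exact hclosed _
    · intro i hi j hj
      have h1 : i ≤ (v.1.support ∪ v.2).sup id := Finset.le_sup (f := id) hi
      have h2 := (le_max_right _ _).trans (hw.le_of_mem j hj)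
      omega
  choose g hgQ hgw hglt hgstar using hstep
  let s₀ : τ := ⟨⟨{([], 0)}, (0, ∅)⟩, fun q hq => by
    rw [Finset.mem_singleton] at hq
    subst hq
    exact hclosed []⟩
  let σ : ℕ → τ := fun n => Nat.rec s₀ (fun n s => g n s) n
  refine ⟨fun n => (σ (n + 1)).1.2, fun n => hgw n (σ n), fun n => hglt (n + 1) (σ (n + 1)), ?_⟩
  intro f hf F hne hsort hsucc
  let T : ℕ → ℕ →₀ ℕ := fun i => subst (σ (i + 1)).1.2.1 (σ (i + 1)).1.2.2 (f i)
  have hQmono : Monotone fun n => (σ n).1.1 := by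
    refine monotone_nat_of_le_succ fun n => ?_
    change _ ≤ (g n (σ n)).1.1
    rw [hgQ]
    intro q hq
    exact Finset.mem_union_left _ (Finset.mem_union_left _ hq)
  have hblock : ∀ (L : List ℕ), L ≠ [] → L.Pairwise (· < ·) → ∀ (i : ℕ) (s : List (ℕ →₀ ℕ))
      (u : ℕ →₀ ℕ), (s, u) ∈ (σ i).1.1 → (∀ b ∈ L, i ≤ b) →
      u + (L.map T).sum ∈ D s ∧ ∃ l ∈ L, (s ++ [u + (L.map T).sum], 0) ∈ (σ (l + 1)).1.1 := by
    intro L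
    induction L with
    | nil => exact fun h => absurd rfl h
    | cons a t ih =>
      intro _ hL i s u hq hi
      have hq : (s, u) ∈ (σ a).1.1 := hQmono (hi a (by simp)) hq
      have hmem : (((s, u), f a) : (List (ℕ →₀ ℕ) × (ℕ →₀ ℕ)) × ℕ) ∈
          (σ a).1.1 ×ˢ Finset.Icc 1 (k a) :=
        Finset.mem_product.2 ⟨hq, Finset.mem_Icc.2 (hf a)⟩
      have hnext : (σ (a + 1)).1.1 = nextStates (σ a).1.1 (σ (a + 1)).1.2 (k a) := hgQ a (σ a)
      rcases eq_or_ne t [] with rfl | ht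
      · simp only [List.map_cons, List.map_nil, List.sum_cons, List.sum_nil, add_zero]
        refine ⟨(hgstar a (σ a) _ hq (f a) (hf a).1 (hf a).2).1, a, by simp, ?_⟩
        rw [hnext]
        exact Finset.mem_union_right _ (Finset.mem_image.2 ⟨_, hmem, rfl⟩)
      · rw [List.pairwise_cons] at hL
        have hq' : (s, u + T a) ∈ (σ (a + 1)).1.1 := by
          rw [hnext]
          exact Finset.mem_union_left _
            (Finset.mem_union_right _ (Finset.mem_image.2 ⟨_, hmem, rfl⟩))
        obtain ⟨h1, l, hl, h2⟩ := ih ht hL.2 (a + 1) s _ hq' fun b hb => hL.1 b hb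
        rw [List.map_cons, List.sum_cons, ← add_assoc]
        exact ⟨h1, l, List.mem_cons_of_mem _ hl, h2⟩
  have hpref : ∀ n, ∃ i, (((List.range n).map fun n => ((F n).map T).sum), 0) ∈ (σ i).1.1 ∧
      ∀ b ∈ F n, i ≤ b := by
    intro n
    induction n with
    | zero => exact ⟨0, by simp [σ, s₀], fun _ _ => Nat.zero_le _⟩
    | succ n ih =>
      obtain ⟨i, hi, hb⟩ := ih
      obtain ⟨-, l, hl, h⟩ := hblock (F n) (hne n) (hsort n) i _ _ hi hb
      refine ⟨l + 1, ?_, fun b hb => hsucc n l hl b hb⟩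
      rw [zero_add] at h
      rwa [List.range_succ, List.map_append, List.map_singleton]
  intro n
  obtain ⟨i, hi, hb⟩ := hpref n
  have := (hblock (F n) (hne n) (hsort n) i _ _ hi hb).1
  rwa [zero_add] at this

end Fusion

section Sums

variable {X : Type*}

lemma coe_listSum1 [AddSemigroup X] [Nonempty X] {l : List X} (hl : l ≠ []) :
    ((listSum1 l : X) : WithZero X) = (l.map fun x : X => (x : WithZero X)).sum := by
  obtain ⟨a, t, rfl⟩ := List.exists_cons_of_ne_nil hl
  simp only [listSum1, List.map_cons, List.sum_cons]
  clear hl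
  induction t generalizing a with
  | nil => simp
  | cons b t ih => rw [List.foldl_cons, ih, WithZero.coe_add, List.map_cons, List.sum_cons,
      add_assoc]

lemma coe_finsetSum1 [AddCommSemigroup X] [Nonempty X] (g : ℕ → X) {E : Finset ℕ}
    (hE : E.Nonempty) : ((finsetSum1 g E : X) : WithZero X) = ∑ j ∈ E, (g j : WithZero X) := by
  rw [finsetSum1, coe_listSum1, List.map_map, ← Multiset.sum_coe, ← Multiset.map_coe,
    Finset.sort_eq]
  · rfl
  · intro h
    rw [List.map_eq_nil_iff] at h
    have := Finset.length_sort (· ≤ ·) (s := E)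
    rw [h] at this
    exact hE.card_pos.ne this

lemma finsetSum1_congr [AddCommSemigroup X] [Nonempty X] {g h : ℕ → X} {E : Finset ℕ}
    (hgh : ∀ j ∈ E, g j = h j) : finsetSum1 g E = finsetSum1 h E := by
  rw [finsetSum1, finsetSum1]
  congr 1
  exact List.map_congr_left fun j hj => hgh j ((Finset.mem_sort _).1 hj)

/-- The value in `X` of a located word. -/
noncomputable def wordSum [AddCommSemigroup X] [Nonempty X] (y : ℕ → ℕ → X) (x : ℕ →₀ ℕ) : X :=
  finsetSum1 (fun j => y (x j) j) x.support

lemma coe_wordSum [AddCommSemigroup X] [Nonempty X] (y : ℕ → ℕ → X) {x : ℕ →₀ ℕ} (hx : x ≠ 0) :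
    ((wordSum y x : X) : WithZero X) = x.sum fun j a => (y a j : WithZero X) :=
  coe_finsetSum1 _ (Finsupp.support_nonempty_iff.2 hx)

lemma disjoint_support_list_sum {b : ℕ →₀ ℕ} {l : List (ℕ →₀ ℕ)}
    (h : ∀ x ∈ l, Disjoint b.support x.support) : Disjoint b.support l.sum.support := by
  induction l with
  | nil => simp
  | cons a t ih =>
    rw [List.sum_cons]
    refine Finset.disjoint_of_subset_right Finsupp.support_add ?_
    rw [Finset.disjoint_union_right]
    exact ⟨h a (by simp), ih fun x hx => h x (List.mem_cons_of_mem _ hx)⟩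

lemma finsupp_sum_list_sum {M : Type*} [AddCommMonoid M] (g : ℕ → ℕ → M) {l : List (ℕ →₀ ℕ)}
    (h : l.Pairwise fun x x' => Disjoint x.support x'.support) :
    l.sum.sum g = (l.map fun x => x.sum g).sum := by
  induction l with
  | nil => simp
  | cons a t ih =>
    rw [List.pairwise_cons] at h
    rw [List.sum_cons, List.map_cons, List.sum_cons,
      Finsupp.sum_add_index_of_disjoint (disjoint_support_list_sum h.1), ih h.2]

lemma wordSum_list_sum [AddCommSemigroup X] [Nonempty X] (y : ℕ → ℕ → X) {l : List (ℕ →₀ ℕ)}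
    (hl : l ≠ []) (h0 : ∀ x ∈ l, x ≠ 0)
    (h : l.Pairwise fun x x' => Disjoint x.support x'.support) :
    wordSum y l.sum = listSum1 (l.map (wordSum y)) := by
  have hsum : l.sum ≠ 0 := by
    obtain ⟨a, t, rfl⟩ := List.exists_cons_of_ne_nil hl
    intro hs
    rw [List.sum_cons, add_eq_zero] at hs
    exact h0 a (by simp) hs.1
  rw [← WithZero.coe_inj, coe_wordSum y hsum, coe_listSum1 (by simpa using hl),
    finsupp_sum_list_sum _ h, List.map_map]
  congr 1
  exact List.map_congr_left fun x hx => (coe_wordSum y (h0 x hx)).symm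

lemma wordSum_subst [AddCommSemigroup X] [Nonempty X] (y : ℕ → ℕ → X) {c : ℕ →₀ ℕ}
    {H : Finset ℕ} (hd : Disjoint c.support H) {a : ℕ} (ha : 1 ≤ a) :
    wordSum y (subst c H a) =
      finsetSum1 (fun j => if j ∈ H then y a j else y (c j) j) (c.support ∪ H) := by
  rw [wordSum, support_subst c H ha]
  refine finsetSum1_congr fun j _ => ?_
  rw [subst_apply]
  split_ifs with h
  · have : c j = 0 := by simpa using Finset.disjoint_right.1 hd h
    rw [this, zero_add]
  · rfl

end Sums

lemma IsOpen.exists_forall_eq_mem {X : Type*} [TopologicalSpace X] [DiscreteTopology X]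
    {V : Set (ℕ → X)} (hV : IsOpen V) {z : ℕ → X} (hz : z ∈ V) :
    ∃ n, ∀ z' : ℕ → X, (∀ i < n, z' i = z i) → z' ∈ V := by
  obtain ⟨I, u, hu, hsub⟩ := isOpen_pi_iff.1 hV z hz
  refine ⟨I.sup id + 1, fun z' h => hsub fun i hi => ?_⟩
  rw [h i (Nat.lt_succ_of_le (Finset.le_sup (f := id) hi))]
  exact (hu i hi).2

/-- **Theorem 3.13** (Milliken–Taylor / van der Waerden type theorem for infinite
sequences in a commutative semigroup). If `U ⊆ X^ℕ` is pointwise closed (for the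
product topology, `X` discrete), then there exist successive nonempty finite sets `Eₙ`
with nonempty `Hₙ ⊆ Eₙ` and `βₙ = Σ_{j ∈ Eₙ∖Hₙ} y_{lⁿⱼ,j}` (with `1 ≤ lⁿⱼ ≤ kⱼ`) such
that for every `f : ℕ → ℕ` with `1 ≤ f n ≤ kₙ`, either
`[FS((βₙ + Σ_{t∈Hₙ} y_{f n,t})ₙ)]^ω ⊆ U` or it is contained in the complement of `U`
(when `Eₙ∖Hₙ = ∅` the `n`-th term is `Σ_{t∈Hₙ} y_{f n,t}`). -/
theorem commutative_semigroup_sequences_partition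
    {X : Type*} [AddCommSemigroup X] [Nonempty X]
    [TopologicalSpace X] [DiscreteTopology X]
    (k : ℕ → ℕ) (hk : ∀ n, 0 < k n) (hmono : Monotone k)
    (y : ℕ → ℕ → X)
    (U : Set (ℕ → X)) (hU : IsClosed U) :
    ∃ (E H : ℕ → Finset ℕ) (lc : ℕ → ℕ → ℕ) (β : ℕ → X),
      (∀ n, (E n).Nonempty) ∧ (∀ n, (H n).Nonempty) ∧ (∀ n, H n ⊆ E n) ∧
      (∀ n, ∀ a ∈ E n, ∀ b ∈ E (n + 1), a < b) ∧
      (∀ n, ∀ j ∈ E n \ H n, 1 ≤ lc n j ∧ lc n j ≤ k j) ∧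
      (∀ n, β n = finsetSum1 (fun j => y (lc n j) j) (E n \ H n)) ∧
      ∀ f : ℕ → ℕ, (∀ n, 1 ≤ f n ∧ f n ≤ k n) →
        FSseq (fun n => finsetSum1
            (fun j => if j ∈ H n then y (f n) j else y (lc n j) j) (E n)) ⊆ U ∨
        FSseq (fun n => finsetSum1
            (fun j => if j ∈ H n then y (f n) j else y (lc n j) j) (E n)) ⊆ Uᶜ := by
  obtain ⟨p, hpp, hline⟩ := exists_idempotent_hasLine hk hmono
  obtain ⟨D, hD, hhom⟩ := exists_homogeneous_tree p {z | (fun n => wordSum y (z n)) ∈ Uᶜ}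
    (fun z hz => by
      obtain ⟨n, hn⟩ := IsOpen.exists_forall_eq_mem hU.isOpen_compl hz
      exact ⟨n, fun z' h => hn _ fun i hi => by rw [h i hi]⟩)
  obtain ⟨w, hw, hlt, hbranch⟩ := exists_fusion hmono hpp hline D hD
  let E : ℕ → Finset ℕ := fun n => (w n).1.support ∪ (w n).2
  have hEne : ∀ n, (E n).Nonempty := fun n => (hw n).nonempty.mono Finset.subset_union_right
  have hElt : ∀ m n, m < n → ∀ i ∈ E m, ∀ j ∈ E n, i < j := by
    intro m n hmn
    induction n, hmn using Nat.le_induction with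
    | base => exact hlt m
    | succ n _ ih =>
      intro i hi j hj
      obtain ⟨l, hl⟩ := hEne n
      exact (ih i hi l hl).trans (hlt n l hl j hj)
  refine ⟨E, fun n => (w n).2, fun n => (w n).1, _, hEne, fun n => (hw n).nonempty,
    fun n => Finset.subset_union_right, hlt, ?_, fun n => rfl, ?_⟩
  · intro n j hj
    have hj' : j ∈ (w n).1.support := by
      rw [Finset.mem_sdiff, Finset.mem_union] at hj
      tauto
    exact ⟨Nat.one_le_iff_ne_zero.2 (Finsupp.mem_support_iff.1 hj'), (hw n).le_bound j⟩
  · intro f hf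
    have key : ∀ z ∈ FSseq (fun n => finsetSum1
        (fun j => if j ∈ (w n).2 then y (f n) j else y ((w n).1 j) j) (E n)),
        ∃ x, IsBranch D x ∧ z = fun n => wordSum y (x n) := by
      rintro z ⟨F, hne, hchain, hsucc, hz⟩
      have hsort : ∀ n, (F n).Pairwise (· < ·) := fun n => List.isChain_iff_pairwise.1 (hchain n)
      refine ⟨_, hbranch f hf F hne hsort hsucc, funext fun n => ?_⟩
      have hsupp : ∀ i, (subst (w i).1 (w i).2 (f i)).support = E i :=
        fun i => support_subst _ _ (hf i).1
      rw [hz, wordSum_list_sum y (by simpa using hne n), List.map_map]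
      · congr 1
        exact List.map_congr_left fun i _ => (wordSum_subst y (hw i).disjoint (hf i).1).symm
      · intro x hx
        obtain ⟨i, -, rfl⟩ := List.mem_map.1 hx
        rw [← Finsupp.support_nonempty_iff, hsupp]
        exact hEne i
      · rw [List.pairwise_map]
        refine (hsort n).imp fun {i j} hij => ?_
        rw [hsupp, hsupp, Finset.disjoint_left]
        exact fun a ha ha' => (hElt i j hij a ha a ha').false
    rcases hhom with h | h
    · right
      intro z hz
      obtain ⟨x, hx, rfl⟩ := key z hz
      exact h x hx
    · left
      intro z hz
      obtain ⟨x, hx, rfl⟩ := key z hz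
      exact not_not.1 (h x hx)

end Farmaki
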